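/- Suppose 0 < β < 1/(2N+1), and let t = (t_0, t_1, …, t_m) ∈ ℝ^{m+1} with 0 = t_0 < t_1 < … < t_m. Then Γ_t = ⋃_{j=0}^m (Γ + t_j) is a self-similar set if and only if either t or its conjugate t̂ is an admissible translation vector. -/

import Mathlib

noncomputable section

namespace HSCantor

/-- A `D`-coding of `x`: a digit sequence `c` with digits in `D ⊆ ℤ` such that
`x = (1-β)/N · Σ_{k=1}^∞ c_k β^{k-1}` (here indexed from `k = 0`). -/
def IsCoding (N : ℕ) (β : ℝ) (D : Set ℤ) (x : ℝ) (c : ℕ → ℤ) : Prop :=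
  (∀ k, c k ∈ D) ∧ x = (1 - β) / N * ∑' k : ℕ, (c k : ℝ) * β ^ k

/-- The set `Γ_{β,D}` for a digit set `D ⊆ ℤ`. -/
def cantorD (N : ℕ) (β : ℝ) (D : Set ℤ) : Set ℝ := { x | ∃ c, IsCoding N β D x c }

/-- The homogeneous symmetric Cantor set `Γ = Γ_{β,{0,1,…,N}}`. -/
def Gamma (N : ℕ) (β : ℝ) : Set ℝ := cantorD N β (Set.Icc 0 (N : ℤ))

/-- `E ⊆ ℝ` is a self-similar set: it is nonempty, compact, and is the union of its
images under finitely many contracting similitudes `x ↦ r x + b`, `0 < |r| < 1`. -/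
def IsSelfSimilar (E : Set ℝ) : Prop :=
  E.Nonempty ∧ IsCompact E ∧ ∃ F : Finset (ℝ × ℝ),
    (∀ p ∈ F, 0 < |p.1| ∧ |p.1| < 1) ∧
    E = ⋃ p ∈ F, (fun x => p.1 * x + p.2) '' E

/-- `Γ_t = ⋃_{j=0}^m (Γ + t_j)`. -/
def GammaT (N : ℕ) (β : ℝ) {m : ℕ} (t : Fin (m + 1) → ℝ) : Set ℝ :=
  ⋃ j, (fun x => x + t j) '' Gamma N β

/-- The set `T = ⋃_{n≥1} { (1-β)/N · Σ_{k=1}^n j_k β^{-k} : j_k ∈ {0,…,N} }`. -/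
def Tset (N : ℕ) (β : ℝ) : Set ℝ :=
  { x | ∃ n : ℕ, 1 ≤ n ∧ ∃ c : ℕ → ℕ, (∀ k, c k ≤ N) ∧
      x = (1 - β) / N * ∑ k ∈ Finset.Icc 1 n, (c k : ℝ) * β ^ (-(k : ℤ)) }

/-- `d` is a digit representation of the translation vector `t` with `τ` digits:
`t_j = (1-β)/N · Σ_{k=1}^τ d_{j,k} β^{-k}` with all digits in `{0,…,N}`. -/
def IsDigitRep (N : ℕ) (β : ℝ) {m : ℕ} (t : Fin (m + 1) → ℝ) (τ : ℕ)
    (d : Fin (m + 1) → ℕ → ℕ) : Prop :=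
  (∀ j k, d j k ≤ N) ∧
    ∀ j, t j = (1 - β) / N * ∑ k ∈ Finset.Icc 1 τ, (d j k : ℝ) * β ^ (-(k : ℤ))

/-- `d` is a digit representation of `t` with `τ = τ_t` digits, `τ_t` minimal. -/
def IsMinimalRep (N : ℕ) (β : ℝ) {m : ℕ} (t : Fin (m + 1) → ℝ) (τ : ℕ)
    (d : Fin (m + 1) → ℕ → ℕ) : Prop :=
  IsDigitRep N β t τ d ∧ ∀ τ' < τ, ∀ d', ¬ IsDigitRep N β t τ' d'

/-- `s_k = max_{0 ≤ j ≤ m} t_{j,k}`. -/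
def digitSup {m : ℕ} (d : Fin (m + 1) → ℕ → ℕ) (k : ℕ) : ℕ :=
  Finset.univ.sup fun j => d j k

/-- Words of length `n` over the alphabet `{0,1,…,N}`, as lists of naturals. -/
def Words (N n : ℕ) : Set (List ℕ) := { w | w.length = n ∧ ∀ x ∈ w, x ≤ N }

/-- `Ω_t^n`: words `i_1 … i_n ∈ {0,…,N}^n` with `i_{n+1-k} ≤ N - s_k` for `1 ≤ k ≤ τ`.
(A list `w = [i_1, …, i_n]` satisfies `i_{n+1-k} = w.getD (n-k) 0`.) -/
def Omega (N τ : ℕ) (s : ℕ → ℕ) (n : ℕ) : Set (List ℕ) :=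
  { w | w ∈ Words N n ∧ ∀ k, 1 ≤ k → k ≤ τ → w.getD (n - k) 0 + s k ≤ N }

/-- `Ω̂_t^n`: words `i_1 … i_n ∈ {0,…,N}^n` with `i_{n+1-k} ≥ s_k` for `1 ≤ k ≤ τ`. -/
def OmegaHat (N τ : ℕ) (s : ℕ → ℕ) (n : ℕ) : Set (List ℕ) :=
  { w | w ∈ Words N n ∧ ∀ k, 1 ≤ k → k ≤ τ → s k ≤ w.getD (n - k) 0 }

/-- `W_t^τ = A_t^τ ∪ Â_t^τ`: words obtained from a word in `Ω_t^τ` (resp. `Ω̂_t^τ`)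
by adding (resp. subtracting) the digits of some `t_j` to the last `τ` positions. -/
def Wset (N : ℕ) {m : ℕ} (τ : ℕ) (d : Fin (m + 1) → ℕ → ℕ) : Set (List ℕ) :=
  { v | ∃ w ∈ Omega N τ (digitSup d) τ, ∃ j : Fin (m + 1),
      v = List.ofFn fun idx : Fin τ => w.getD idx 0 + d j (τ - (idx : ℕ)) } ∪
  { v | ∃ w ∈ OmegaHat N τ (digitSup d) τ, ∃ j : Fin (m + 1),
      v = List.ofFn fun idx : Fin τ => w.getD idx 0 - d j (τ - (idx : ℕ)) }

/-- The symbolic admissibility condition: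
`⋃_{n=τ}^ℓ {0,…,N}^{n-τ} × W_t^τ × {0,…,N}^{ℓ-n} = {0,…,N}^ℓ` for some `ℓ ≥ τ`. -/
def AdmissibleWith (N : ℕ) {m : ℕ} (τ : ℕ) (d : Fin (m + 1) → ℕ → ℕ) : Prop :=
  ∃ ℓ, τ ≤ ℓ ∧
    (⋃ n ∈ Finset.Icc τ ℓ,
      { z : List ℕ | ∃ u ∈ Words N (n - τ), ∃ w ∈ Wset N τ d, ∃ v ∈ Words N (ℓ - n),
          z = u ++ w ++ v }) = Words N ℓ

/-- `t` is an admissible translation vector. -/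
def IsAdmissible (N : ℕ) (β : ℝ) {m : ℕ} (t : Fin (m + 1) → ℝ) : Prop :=
  (∀ j, t j ∈ Tset N β) ∧
    ∃ τ d, IsMinimalRep N β t τ d ∧ AdmissibleWith N τ d

/-- The vertex set `V_t = {0,…,N}^τ \ W_t^τ` of the directed graph `G_t`. -/
def Vset (N : ℕ) {m : ℕ} (τ : ℕ) (d : Fin (m + 1) → ℕ → ℕ) : Set (List ℕ) :=
  Words N τ \ Wset N τ d

/-- The graph on `V` with an edge `i → j` iff `i_2 … i_τ = j_1 … j_{τ-1}` has a cycle: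
a directed path of positive length starting and ending at the same vertex. -/
def HasCycle (V : Set (List ℕ)) : Prop :=
  ∃ (L : ℕ) (p : ℕ → List ℕ), 0 < L ∧ (∀ i ≤ L, p i ∈ V) ∧
    (∀ i < L, (p i).drop 1 = (p (i + 1)).dropLast) ∧ p 0 = p L

open Classical in
/-- The adjacency matrix of the directed graph `G_t`, indexed by all words of length `τ`
over `{0,…,N}`; its `(i,j)` entry is `1` exactly when `i, j ∈ V_t` and there is a
directed edge `i → j`, and the rows and columns outside `V_t` are zero. -/
def adjMat (N τ : ℕ) (V : Set (List ℕ)) :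
    Matrix (Fin τ → Fin (N + 1)) (Fin τ → Fin (N + 1)) ℕ :=
  fun i j =>
    if (List.ofFn fun k => (i k : ℕ)) ∈ V ∧ (List.ofFn fun k => (j k : ℕ)) ∈ V ∧
        (List.ofFn fun k => (i k : ℕ)).drop 1 = (List.ofFn fun k => (j k : ℕ)).dropLast
    then 1 else 0

/-- `φ_i(x) = βx + i(1-β)/N`. -/
def phi (N : ℕ) (β : ℝ) (i : ℕ) (x : ℝ) : ℝ := β * x + i * (1 - β) / N

/-- `φ_{i_1 … i_n} = φ_{i_1} ∘ ⋯ ∘ φ_{i_n}`. -/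
def phiWord (N : ℕ) (β : ℝ) (w : List ℕ) (x : ℝ) : ℝ := w.foldr (phi N β) x

/-- The conjugate translation vector `t̂_j = t_m - t_{m-j}`. -/
def conj {m : ℕ} (t : Fin (m + 1) → ℝ) : Fin (m + 1) → ℝ :=
  fun j => t (Fin.last m) - t ⟨m - (j : ℕ), Nat.lt_succ_of_le (Nat.sub_le m j)⟩

/-- The standing assumptions `0 < N` and `0 < β < 1/(2N+1)`. -/
structure Small (N : ℕ) (β : ℝ) : Prop where
  N_pos : 0 < N
  pos : 0 < β
  lt : β * (2 * N + 1) < 1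

namespace Small

variable {N : ℕ} {β : ℝ}

lemma cast_pos (h : Small N β) : (0 : ℝ) < N := by exact_mod_cast h.N_pos

lemma one_le_cast (h : Small N β) : (1 : ℝ) ≤ N := by exact_mod_cast h.N_pos

lemma lt_one (h : Small N β) : β < 1 := by
  nlinarith [h.lt, h.pos, h.one_le_cast]

lemma step_pos (h : Small N β) : 0 < (1 - β) / N :=
  div_pos (sub_pos.2 h.lt_one) h.cast_pos

lemma step_mul (h : Small N β) : (1 - β) / N * N = 1 - β :=
  div_mul_cancel₀ _ h.cast_pos.ne'

lemma gap_pos (h : Small N β) : 0 < (1 - β) / N - β := by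
  rw [sub_pos, lt_div_iff₀ h.cast_pos]
  nlinarith [h.lt, h.pos, h.one_le_cast]

end Small

/-- `a` is a sequence of digits in `{0,…,N}`. -/
def IsDigits (N : ℕ) (a : ℕ → ℤ) : Prop := ∀ k, a k ∈ Set.Icc 0 (N : ℤ)

/-- The left endpoint `(1-β)/N · Σ_{k<n} a_k β^k` of the level-`n` cylinder with digits `a`. -/
def cylVal (N : ℕ) (β : ℝ) (n : ℕ) (a : ℕ → ℤ) : ℝ :=
  (1 - β) / N * ∑ k ∈ Finset.range n, (a k : ℝ) * β ^ k

/-- The digit sequence `i, a_0, a_1, …`. -/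
def consDigit (i : ℤ) (a : ℕ → ℤ) : ℕ → ℤ
  | 0 => i
  | k + 1 => a k

variable {N : ℕ} {β : ℝ}

lemma IsDigits.cons {i : ℤ} {a : ℕ → ℤ} (hi : i ∈ Set.Icc 0 (N : ℤ)) (ha : IsDigits N a) :
    IsDigits N (consDigit i a)
  | 0 => hi
  | k + 1 => ha k

lemma IsDigits.tail {a : ℕ → ℤ} (ha : IsDigits N a) : IsDigits N fun k => a (k + 1) :=
  fun k => ha (k + 1)

lemma isDigits_zero : IsDigits N 0 := fun _ => by simp

lemma cylVal_zero (a : ℕ → ℤ) : cylVal N β 0 a = 0 := by simp [cylVal]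

lemma cylVal_succ (n : ℕ) (a : ℕ → ℤ) :
    cylVal N β (n + 1) a = (1 - β) / N * a 0 + β * cylVal N β n fun k => a (k + 1) := by
  simp only [cylVal, Finset.sum_range_succ', pow_zero, mul_one, mul_add, Finset.mul_sum]
  rw [add_comm]
  congr 1
  exact Finset.sum_congr rfl fun k _ => by ring

lemma cylVal_succ_right (n : ℕ) (a : ℕ → ℤ) :
    cylVal N β (n + 1) a = cylVal N β n a + (1 - β) / N * (a n * β ^ n) := by
  simp only [cylVal, Finset.sum_range_succ, mul_add]

lemma cylVal_cons (n : ℕ) (i : ℤ) (a : ℕ → ℤ) :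
    cylVal N β (n + 1) (consDigit i a) = (1 - β) / N * i + β * cylVal N β n a :=
  cylVal_succ n _

lemma cylVal_congr {n : ℕ} {a b : ℕ → ℤ} (h : ∀ k < n, a k = b k) :
    cylVal N β n a = cylVal N β n b := by
  unfold cylVal
  congr 1
  exact Finset.sum_congr rfl fun k hk => by rw [h k (Finset.mem_range.1 hk)]

lemma cylVal_add (n : ℕ) (a b : ℕ → ℤ) :
    cylVal N β n (a + b) = cylVal N β n a + cylVal N β n b := by
  simp only [cylVal, ← mul_add, ← Finset.sum_add_distrib, Pi.add_apply, Int.cast_add, add_mul]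

lemma cylVal_sub (n : ℕ) (a b : ℕ → ℤ) :
    cylVal N β n (a - b) = cylVal N β n a - cylVal N β n b := by
  simp only [cylVal, ← mul_sub, ← Finset.sum_sub_distrib, Pi.sub_apply, Int.cast_sub, sub_mul]

lemma IsDigits.norm_le (h : Small N β) {a : ℕ → ℤ} (ha : IsDigits N a) (k : ℕ) :
    ‖(a k : ℝ) * β ^ k‖ ≤ N * β ^ k := by
  have h0 : (0 : ℝ) ≤ a k := by exact_mod_cast (ha k).1
  have h1 : (a k : ℝ) ≤ N := by exact_mod_cast (ha k).2
  have hb := pow_pos h.pos k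
  rw [Real.norm_of_nonneg (by positivity)]
  gcongr

lemma summable_bound (h : Small N β) : Summable fun k : ℕ => (N : ℝ) * β ^ k :=
  (summable_geometric_of_lt_one h.pos.le h.lt_one).mul_left _

lemma IsDigits.summable (h : Small N β) {a : ℕ → ℤ} (ha : IsDigits N a) :
    Summable fun k => (a k : ℝ) * β ^ k :=
  (summable_bound h).of_norm_bounded (ha.norm_le h)

lemma tsum_digits_eq (h : Small N β) {a : ℕ → ℤ} (ha : IsDigits N a) :
    ∑' k, (a k : ℝ) * β ^ k = a 0 + β * ∑' k, (a (k + 1) : ℝ) * β ^ k := by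
  rw [(ha.summable h).tsum_eq_zero_add, ← tsum_mul_left]
  simp only [pow_zero, mul_one, pow_succ]
  congr 1
  exact tsum_congr fun k => by ring

lemma mem_Gamma_iff {x : ℝ} :
    x ∈ Gamma N β ↔ ∃ a, IsDigits N a ∧ x = (1 - β) / N * ∑' k : ℕ, (a k : ℝ) * β ^ k :=
  Iff.rfl

/-- The invariance `Γ = ⋃ φ_i(Γ)`. -/
lemma mem_Gamma_iff_step (h : Small N β) {x : ℝ} :
    x ∈ Gamma N β ↔
      ∃ i ∈ Set.Icc 0 (N : ℤ), ∃ y ∈ Gamma N β, x = (1 - β) / N * i + β * y := by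
  constructor
  · rintro ⟨a, ha, rfl⟩
    refine ⟨a 0, ha 0, _, ⟨fun k => a (k + 1), fun k => ha (k + 1), rfl⟩, ?_⟩
    rw [tsum_digits_eq h ha]
    ring
  · rintro ⟨i, hi, y, ⟨a, ha, rfl⟩, rfl⟩
    have hc : IsDigits N (consDigit i a) := IsDigits.cons hi ha
    refine ⟨consDigit i a, hc, ?_⟩
    rw [tsum_digits_eq h hc]
    simp only [consDigit]
    ring

lemma Gamma_subset_Icc (h : Small N β) : Gamma N β ⊆ Set.Icc 0 1 := by
  rintro x ⟨a, ha : IsDigits N a, rfl⟩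
  constructor
  · refine mul_nonneg h.step_pos.le (tsum_nonneg fun k => mul_nonneg ?_ (pow_pos h.pos k).le)
    exact_mod_cast (ha k).1
  · have hle : ∑' k : ℕ, (a k : ℝ) * β ^ k ≤ N * (1 - β)⁻¹ := by
      rw [← tsum_geometric_of_lt_one h.pos.le h.lt_one, ← tsum_mul_left]
      exact (ha.summable h).tsum_le_tsum (fun k => (le_abs_self _).trans (ha.norm_le h k))
        (summable_bound h)
    have h1 : 0 < 1 - β := sub_pos.2 h.lt_one
    calc _ ≤ (1 - β) / N * (N * (1 - β)⁻¹) := mul_le_mul_of_nonneg_left hle h.step_pos.le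
      _ = 1 := by rw [← mul_assoc, h.step_mul, mul_inv_cancel₀ h1.ne']

lemma zero_mem_Gamma : (0 : ℝ) ∈ Gamma N β := ⟨0, fun k => by simp, by simp⟩

lemma one_sub_mem_Gamma (h : Small N β) {x : ℝ} (hx : x ∈ Gamma N β) : 1 - x ∈ Gamma N β := by
  obtain ⟨a, ha, rfl⟩ := hx
  have ha' : IsDigits N a := ha
  refine ⟨fun k => N - a k, fun k => ?_, ?_⟩
  · have := ha' k
    simp only [Set.mem_Icc] at this ⊢
    omega
  · push_cast
    simp only [sub_mul]
    rw [(summable_bound h).tsum_sub (ha'.summable h), tsum_mul_left,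
      tsum_geometric_of_lt_one h.pos.le h.lt_one, mul_sub, ← mul_assoc, h.step_mul,
      mul_inv_cancel₀ (sub_pos.2 h.lt_one).ne']

lemma one_mem_Gamma (h : Small N β) : (1 : ℝ) ∈ Gamma N β := by
  simpa using one_sub_mem_Gamma h zero_mem_Gamma

lemma isCompact_Gamma (h : Small N β) : IsCompact (Gamma N β) := by
  have hK : IsCompact (Set.pi Set.univ fun _ : ℕ => Set.Icc 0 (N : ℤ)) :=
    isCompact_univ_pi fun _ => (Set.finite_Icc _ _).isCompact
  have hf : ContinuousOn (fun a : ℕ → ℤ => (1 - β) / N * ∑' k : ℕ, (a k : ℝ) * β ^ k)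
      (Set.pi Set.univ fun _ : ℕ => Set.Icc 0 (N : ℤ)) := by
    refine continuousOn_const.mul (continuousOn_tsum (fun k => ?_) (summable_bound h) ?_)
    · have : Continuous fun z : ℤ => (z : ℝ) := continuous_of_discreteTopology
      exact ((this.comp (continuous_apply k)).mul continuous_const).continuousOn
    · intro k a ha
      exact IsDigits.norm_le h (fun k => ha k trivial) k
  convert hK.image_of_continuousOn hf using 1
  ext x
  simp only [mem_Gamma_iff, Set.mem_image, Set.mem_pi, Set.mem_univ, true_imp_iff, IsDigits,
    eq_comm]

lemma cylVal_add_mem (h : Small N β) (n : ℕ) {a : ℕ → ℤ} (ha : ∀ k < n, a k ∈ Set.Icc 0 (N : ℤ))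
    {x : ℝ} (hx : x ∈ Gamma N β) : cylVal N β n a + β ^ n * x ∈ Gamma N β := by
  induction n generalizing a with
  | zero => simpa [cylVal_zero]
  | succ n ih =>
    refine (mem_Gamma_iff_step h).2 ⟨a 0, ha 0 (by omega), _,
      ih (a := fun k => a (k + 1)) fun k hk => ha _ (by omega), ?_⟩
    rw [cylVal_succ]
    ring

/-- A point of `Γ` with digit sequence `a` lies in all the cylinders given by `a`. -/
lemma exists_tail (h : Small N β) {a : ℕ → ℤ} (ha : IsDigits N a) (n : ℕ) :
    ∃ y ∈ Gamma N β,
      (1 - β) / N * ∑' k : ℕ, (a k : ℝ) * β ^ k = cylVal N β n a + β ^ n * y := by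
  refine ⟨_, ⟨fun k => a (k + n), fun k => ha _, rfl⟩, ?_⟩
  rw [← (ha.summable h).sum_add_tsum_nat_add n, mul_add, cylVal,
    mul_left_comm (β ^ n), ← tsum_mul_left (a := β ^ n)]
  congr 2
  exact tsum_congr fun k => by ring

/-- Distinct first level cylinders are separated by at least the first gap. -/
lemma digit_eq_of_abs_lt (h : Small N β) {i j : ℤ} {u v : ℝ} (hu : u ∈ Gamma N β)
    (hv : v ∈ Gamma N β)
    (huv : |(1 - β) / N * i + β * u - ((1 - β) / N * j + β * v)| < (1 - β) / N - β) : i = j := by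
  have hu := Gamma_subset_Icc h hu
  have hv := Gamma_subset_Icc h hv
  have hlt := abs_lt.1 huv
  have hs := h.step_pos
  have hβ := h.pos
  by_contra hne
  rcases Int.lt_or_gt_of_ne hne with hneg | hpos
  · have : (i : ℝ) + 1 ≤ j := by exact_mod_cast hneg
    nlinarith [hlt.1, hu.1, hu.2, hv.1, hv.2]
  · have : (j : ℝ) + 1 ≤ i := by exact_mod_cast hpos
    nlinarith [hlt.2, hu.1, hu.2, hv.1, hv.2]

/-- Distinct cylinders of level `n` are separated by at least `β^n` times the first gap. -/
lemma digits_eq_of_abs_lt (h : Small N β) (n : ℕ) {a b : ℕ → ℤ} (ha : IsDigits N a)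
    (hb : IsDigits N b) {x y : ℝ} (hx : x ∈ Gamma N β) (hy : y ∈ Gamma N β)
    (hxy : |cylVal N β n a + β ^ n * x - (cylVal N β n b + β ^ n * y)| <
      ((1 - β) / N - β) * β ^ n) :
    ∀ k < n, a k = b k := by
  induction n generalizing a b with
  | zero => intro k hk; omega
  | succ n ih =>
    have hrw : ∀ (a : ℕ → ℤ) (x : ℝ), cylVal N β (n + 1) a + β ^ (n + 1) * x =
        (1 - β) / N * a 0 + β * (cylVal N β n (fun k => a (k + 1)) + β ^ n * x) := by
      intro a x
      rw [cylVal_succ]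
      ring
    rw [hrw, hrw] at hxy
    have hβ := h.pos
    have hpow : β ^ (n + 1) ≤ 1 := pow_le_one₀ hβ.le h.lt_one.le
    have h0 : a 0 = b 0 := digit_eq_of_abs_lt h
      (cylVal_add_mem h n (fun k _ => ha.tail k) hx) (cylVal_add_mem h n (fun k _ => hb.tail k) hy)
      (hxy.trans_le (mul_le_of_le_one_right h.gap_pos.le hpow))
    rw [h0, add_sub_add_left_eq_sub, ← mul_sub, abs_mul, abs_of_pos hβ, pow_succ] at hxy
    rintro (_ | k) hk
    · exact h0
    · exact ih ha.tail hb.tail (lt_of_mul_lt_mul_left (hxy.trans_eq (by ring)) hβ.le) k (by omega)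

/-- Finite expansions with integer digits in `[-2N, 2N]` are unique. -/
lemma digits_eq_zero_of_cylVal_eq_zero (h : Small N β) (n : ℕ) {e : ℕ → ℤ}
    (he : ∀ k < n, |e k| ≤ 2 * N) (h0 : cylVal N β n e = 0) : ∀ k < n, e k = 0 := by
  have hbound : ∀ (n : ℕ) (e : ℕ → ℤ), (∀ k < n, |e k| ≤ 2 * N) → |cylVal N β n e| ≤ 2 := by
    intro n
    induction n with
    | zero => intro e _; simp [cylVal_zero]
    | succ n ih =>
      intro e he
      have h1 := abs_le.1 (ih (fun k => e (k + 1)) fun k hk => he _ (by omega))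
      have h2 : |(e 0 : ℝ)| ≤ 2 * N := by exact_mod_cast he 0 (by omega)
      have h2 := abs_le.1 h2
      have hs := h.step_pos
      have hsN := h.step_mul
      rw [cylVal_succ, abs_le]
      constructor <;> nlinarith [h.pos]
  induction n generalizing e with
  | zero => intro k hk; omega
  | succ n ih =>
    have h1 := abs_le.1 (hbound n (fun k => e (k + 1)) fun k hk => he _ (by omega))
    rw [cylVal_succ] at h0
    have hs := h.step_pos
    have hsN := h.step_mul
    have hstep : 2 * β < (1 - β) / N := by
      rw [lt_div_iff₀ h.cast_pos]
      linarith [h.lt]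
    have he0 : e 0 = 0 := by
      by_contra hne
      rcases Int.lt_or_gt_of_ne hne with hneg | hpos
      · have : (e 0 : ℝ) ≤ -1 := by exact_mod_cast (by omega : e 0 ≤ -1)
        nlinarith [h.pos]
      · have : (1 : ℝ) ≤ e 0 := by exact_mod_cast (by omega : 1 ≤ e 0)
        nlinarith [h.pos]
    have hrest : cylVal N β n (fun k => e (k + 1)) = 0 := by
      rw [he0, Int.cast_zero, mul_zero, zero_add] at h0
      exact (mul_eq_zero.1 h0).resolve_left h.pos.ne'
    rintro (_ | k) hk
    · exact he0
    · exact ih (fun k hk => he _ (by omega)) hrest k (by omega)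

/-- `Γ` is `δ`-chain connected as soon as `δ` is at least the length of its first gaps. -/
lemma Gamma_chain (h : Small N β) {δ : ℝ} (hδ : (1 - β) / N - β ≤ δ) {U : ℝ → Prop}
    (hU : ∀ x ∈ Gamma N β, ∀ y ∈ Gamma N β, |x - y| ≤ δ → U x → U y)
    {x y : ℝ} (hx : x ∈ Gamma N β) (hy : y ∈ Gamma N β) (hUx : U x) : U y := by
  have hβ := h.pos
  obtain ⟨n, hn⟩ : ∃ n : ℕ, β ^ n ≤ δ :=
    (exists_pow_lt_of_lt_one (h.gap_pos.trans_le hδ) h.lt_one).imp fun _ => le_of_lt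
  induction n generalizing δ U x y with
  | zero =>
    refine hU x hx y hy ?_ hUx
    have h1 := Gamma_subset_Icc h hx
    have h2 := Gamma_subset_Icc h hy
    rw [pow_zero] at hn
    rw [abs_le]
    constructor <;> linarith [h1.1, h1.2, h2.1, h2.2]
  | succ n ih =>
    have hδ0 : 0 < δ := h.gap_pos.trans_le hδ
    have hpiece : ∀ i ∈ Set.Icc 0 (N : ℤ), ∀ u ∈ Gamma N β, ∀ v ∈ Gamma N β,
        U ((1 - β) / N * i + β * u) → U ((1 - β) / N * i + β * v) := by
      intro i hi u hu v hv hUu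
      refine ih (δ := δ / β) (U := fun z => U ((1 - β) / N * i + β * z)) ?_ ?_ hu hv hUu ?_
      · exact hδ.trans (le_div_self hδ0.le hβ h.lt_one.le)
      · intro p hp q hq hpq
        refine hU _ ((mem_Gamma_iff_step h).2 ⟨i, hi, p, hp, rfl⟩) _
          ((mem_Gamma_iff_step h).2 ⟨i, hi, q, hq, rfl⟩) ?_
        rw [show (1 - β) / N * i + β * p - ((1 - β) / N * i + β * q) = β * (p - q) by ring,
          abs_mul, abs_of_pos hβ, mul_comm]
        exact (le_div_iff₀ hβ).1 hpq
      · rwa [le_div_iff₀ hβ, ← pow_succ]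
    have hcross : ∀ i : ℤ, 0 ≤ i → i + 1 ≤ N →
        (U ((1 - β) / N * i + β * 0) ↔ U ((1 - β) / N * (i + 1 : ℤ) + β * 0)) := by
      intro i h0 h1
      have hi : i ∈ Set.Icc 0 (N : ℤ) := ⟨h0, by omega⟩
      have hi' : i + 1 ∈ Set.Icc 0 (N : ℤ) := ⟨by omega, h1⟩
      have hp := (mem_Gamma_iff_step h).2 ⟨i, hi, 1, one_mem_Gamma h, rfl⟩
      have hq := (mem_Gamma_iff_step h).2 ⟨i + 1, hi', 0, zero_mem_Gamma, rfl⟩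
      have hd : |(1 - β) / N * i + β * 1 - ((1 - β) / N * (i + 1 : ℤ) + β * 0)| ≤ δ := by
        push_cast
        rw [show (1 - β) / N * i + β * 1 - ((1 - β) / N * ((i : ℝ) + 1) + β * 0)
          = -((1 - β) / N - β) by ring, abs_neg, abs_of_pos h.gap_pos]
        exact hδ
      constructor
      · intro hu
        exact hU _ hp _ hq hd (hpiece i hi 0 zero_mem_Gamma 1 (one_mem_Gamma h) hu)
      · intro hu
        rw [abs_sub_comm] at hd
        exact hpiece i hi 1 (one_mem_Gamma h) 0 zero_mem_Gamma (hU _ hq _ hp hd hu)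
    have hbase : ∀ i : ℕ, i ≤ N →
        (U ((1 - β) / N * (0 : ℤ) + β * 0) ↔ U ((1 - β) / N * (i : ℤ) + β * 0)) := by
      intro i
      induction i with
      | zero => intro _; rfl
      | succ i ihi =>
        intro hi
        exact (ihi (by omega)).trans (hcross i (by omega) (by omega))
    obtain ⟨i, hi, u, hu, rfl⟩ := (mem_Gamma_iff_step h).1 hx
    obtain ⟨j, hj, v, hv, rfl⟩ := (mem_Gamma_iff_step h).1 hy
    refine hpiece j hj 0 zero_mem_Gamma v hv ?_
    have hUi := hpiece i hi u hu 0 zero_mem_Gamma hUx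
    lift i to ℕ using hi.1
    lift j to ℕ using hj.1
    exact (hbase j (by exact_mod_cast hj.2)).1 ((hbase i (by exact_mod_cast hi.2)).2 hUi)

/-- Classification of the similitudes mapping `Γ` into itself. -/
lemma similitude_of_mapsTo (h : Small N β) {r b : ℝ} (hr : r ≠ 0)
    (hf : ∀ x ∈ Gamma N β, r * x + b ∈ Gamma N β) :
    ∃ n a, IsDigits N a ∧ ((r = β ^ n ∧ b = cylVal N β n a) ∨
      (r = -β ^ n ∧ b = cylVal N β n a + β ^ n)) := by
  have hβ := h.pos
  have hbig : ∀ r b : ℝ, (∀ x ∈ Gamma N β, r * x + b ∈ Gamma N β) → 1 ≤ |r| →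
      ∃ n a, IsDigits N a ∧ ((r = β ^ n ∧ b = cylVal N β n a) ∨
        (r = -β ^ n ∧ b = cylVal N β n a + β ^ n)) := by
    intro r b hf hr1
    have h0 := Gamma_subset_Icc h (hf 0 zero_mem_Gamma)
    have h1 := Gamma_subset_Icc h (hf 1 (one_mem_Gamma h))
    simp only [mul_zero, mul_one, zero_add, Set.mem_Icc] at h0 h1
    refine ⟨0, 0, isDigits_zero, ?_⟩
    rw [cylVal_zero, pow_zero]
    rcases le_abs.1 hr1 with hr1 | hr1
    · left; constructor <;> linarith
    · right; constructor <;> linarith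
  obtain ⟨n, hn⟩ : ∃ n : ℕ, β ^ n ≤ |r| :=
    (exists_pow_lt_of_lt_one (abs_pos.2 hr) h.lt_one).imp fun _ => le_of_lt
  induction n generalizing r b with
  | zero => exact hbig r b hf (by simpa using hn)
  | succ n ih =>
    rcases le_or_gt 1 |r| with hr1 | hr1
    · exact hbig r b hf hr1
    obtain ⟨i, hi, y, hy, hiy⟩ := (mem_Gamma_iff_step h).1 (hf 0 zero_mem_Gamma)
    have hall : ∀ x ∈ Gamma N β, ∃ z ∈ Gamma N β, r * x + b = (1 - β) / N * i + β * z := by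
      intro x hx
      refine Gamma_chain h le_rfl
        (U := fun x => ∃ z ∈ Gamma N β, r * x + b = (1 - β) / N * i + β * z) ?_
        zero_mem_Gamma hx ⟨y, hy, hiy⟩
      rintro p hp q hq hpq ⟨z, hz, hpz⟩
      obtain ⟨j, hj, w, hw, hqw⟩ := (mem_Gamma_iff_step h).1 (hf q hq)
      have hij : i = j := by
        refine digit_eq_of_abs_lt h hz hw ?_
        rw [← hpz, ← hqw, add_sub_add_right_eq_sub, ← mul_sub, abs_mul]
        nlinarith [abs_nonneg (p - q), abs_nonneg r, h.gap_pos]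
      exact ⟨w, hw, hij ▸ hqw⟩
    have hf' : ∀ x ∈ Gamma N β, r / β * x + (b - (1 - β) / N * i) / β ∈ Gamma N β := by
      intro x hx
      obtain ⟨z, hz, hxz⟩ := hall x hx
      rwa [div_mul_eq_mul_div, ← add_div, ← add_sub_assoc, hxz, add_sub_cancel_left,
        mul_div_cancel_left₀ _ hβ.ne']
    obtain ⟨k, a, ha, hka⟩ := ih (div_ne_zero hr hβ.ne') hf' (by
      rwa [abs_div, abs_of_pos hβ, le_div_iff₀ hβ, ← pow_succ])
    refine ⟨k + 1, consDigit i a, ha.cons hi, ?_⟩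
    rw [cylVal_cons, pow_succ]
    simp only [div_eq_iff hβ.ne'] at hka
    rcases hka with ⟨h1, h2⟩ | ⟨h1, h2⟩
    · left; constructor <;> linarith
    · right; constructor <;> linarith

section SelfSimilar

variable {E : Set ℝ}

lemma isSelfSimilar_iff :
    IsSelfSimilar E ↔ E.Nonempty ∧ IsCompact E ∧ ∃ F : Finset (ℝ × ℝ),
      (∀ p ∈ F, 0 < |p.1| ∧ |p.1| < 1) ∧ (∀ p ∈ F, ∀ x ∈ E, p.1 * x + p.2 ∈ E) ∧
        ∀ x ∈ E, ∃ p ∈ F, ∃ y ∈ E, p.1 * y + p.2 = x := by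
  refine and_congr_right fun _ => and_congr_right fun _ => exists_congr fun F =>
    and_congr_right fun _ => ?_
  rw [Set.Subset.antisymm_iff, and_comm]
  refine and_congr ?_ ?_
  · simp only [Set.iUnion_subset_iff, Set.image_subset_iff]
    rfl
  · simp only [Set.subset_def, Set.mem_iUnion, Set.mem_image, exists_prop]

lemma IsSelfSimilar.reflect (hE : IsSelfSimilar E) (M : ℝ) :
    IsSelfSimilar ((fun x => M - x) '' E) := by
  obtain ⟨hne, hc, F, hF, hmaps, hcov⟩ := isSelfSimilar_iff.1 hE
  refine isSelfSimilar_iff.2 ⟨hne.image _, hc.image (by fun_prop),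
    F.image fun p => (p.1, M - p.1 * M - p.2), ?_, ?_, ?_⟩
  · intro q hq
    obtain ⟨p, hp, rfl⟩ := Finset.mem_image.1 hq
    exact hF p hp
  · rintro q hq _ ⟨x, hx, rfl⟩
    obtain ⟨p, hp, rfl⟩ := Finset.mem_image.1 hq
    exact ⟨_, hmaps p hp x hx, by ring⟩
  · rintro _ ⟨x, hx, rfl⟩
    obtain ⟨p, hp, y, hy, rfl⟩ := hcov x hx
    exact ⟨_, Finset.mem_image_of_mem _ hp, _, ⟨y, hy, rfl⟩, by ring⟩

/-- A self-similar set is generated by arbitrarily strong contractions. -/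
lemma IsSelfSimilar.exists_small (hE : IsSelfSimilar E) {ε : ℝ} (hε : 0 < ε) :
    ∃ F : Finset (ℝ × ℝ), (∀ p ∈ F, 0 < |p.1| ∧ |p.1| < ε) ∧
      (∀ p ∈ F, ∀ x ∈ E, p.1 * x + p.2 ∈ E) ∧ ∀ x ∈ E, ∃ p ∈ F, ∃ y ∈ E, p.1 * y + p.2 = x := by
  obtain ⟨⟨x₀, hx₀⟩, -, F, hF, hmaps, hcov⟩ := isSelfSimilar_iff.1 hE
  have hne : F.Nonempty := (hcov x₀ hx₀).imp fun _ hp => hp.1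
  obtain ⟨q, hq, hmax⟩ := F.exists_max_image (fun p => |p.1|) hne
  have hiter : ∀ k : ℕ, ∃ G : Finset (ℝ × ℝ), (∀ p ∈ G, 0 < |p.1| ∧ |p.1| ≤ |q.1| ^ k) ∧
      (∀ p ∈ G, ∀ x ∈ E, p.1 * x + p.2 ∈ E) ∧
        ∀ x ∈ E, ∃ p ∈ G, ∃ y ∈ E, p.1 * y + p.2 = x := by
    intro k
    induction k with
    | zero => exact ⟨{(1, 0)}, by simp⟩
    | succ k ih =>
      obtain ⟨G, hG, hGmaps, hGcov⟩ := ih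
      refine ⟨(F ×ˢ G).image fun p => (p.1.1 * p.2.1, p.1.1 * p.2.2 + p.1.2), ?_, ?_, ?_⟩
      · intro p hp
        obtain ⟨⟨a, b⟩, hab, rfl⟩ := Finset.mem_image.1 hp
        obtain ⟨ha, hb⟩ := Finset.mem_product.1 hab
        rw [abs_mul, pow_succ']
        exact ⟨mul_pos (hF a ha).1 (hG b hb).1,
          mul_le_mul (hmax a ha) (hG b hb).2 (abs_nonneg _) (abs_nonneg _)⟩
      · intro p hp x hx
        obtain ⟨⟨a, b⟩, hab, rfl⟩ := Finset.mem_image.1 hp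
        obtain ⟨ha, hb⟩ := Finset.mem_product.1 hab
        convert hmaps a ha _ (hGmaps b hb x hx) using 1
        ring
      · intro x hx
        obtain ⟨a, ha, y, hy, rfl⟩ := hcov x hx
        obtain ⟨b, hb, z, hz, rfl⟩ := hGcov y hy
        exact ⟨_, Finset.mem_image_of_mem _ (Finset.mk_mem_product ha hb), z, hz, by ring⟩
  obtain ⟨k, hk⟩ := exists_pow_lt_of_lt_one hε (hF q hq).2
  obtain ⟨G, hG, hG'⟩ := hiter k
  exact ⟨G, fun p hp => ⟨(hG p hp).1, (hG p hp).2.trans_lt hk⟩, hG'⟩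

/-- A self-similar subset of `[0, M]` containing `0` and `M` is mapped into itself by an
orientation preserving contraction fixing `0` or `M`. -/
lemma IsSelfSimilar.exists_fixing_endpoint (hE : IsSelfSimilar E) {M : ℝ}
    (hsub : E ⊆ Set.Icc 0 M) (h0 : (0 : ℝ) ∈ E) (h1 : M ∈ E) :
    ∃ r, 0 < r ∧ r < 1 ∧ ((∀ x ∈ E, r * x ∈ E) ∨ ∀ x ∈ E, M - r * (M - x) ∈ E) := by
  obtain ⟨-, -, F, hF, hmaps, hcov⟩ := isSelfSimilar_iff.1 hE
  obtain ⟨⟨r, b⟩, hp, y, hy, hry⟩ := hcov 0 h0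
  obtain ⟨⟨s, c⟩, hq, z, hz, hsz⟩ := hcov M h1
  have hr := hF _ hp
  have hs := hF _ hq
  have hr0 := hsub (hmaps _ hp 0 h0)
  have hrM := hsub (hmaps _ hp M h1)
  have hs0 := hsub (hmaps _ hq 0 h0)
  have hsM := hsub (hmaps _ hq M h1)
  have hy' := hsub hy
  have hz' := hsub hz
  simp only [Set.mem_Icc, mul_zero, zero_add] at hr hs hr0 hrM hs0 hsM hry hsz hy' hz'
  rcases lt_or_gt_of_ne (abs_pos.1 hr.1) with hrn | hrp
  · rcases lt_or_gt_of_ne (abs_pos.1 hs.1) with hsn | hsp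
    · have hb : b = -r * M := by nlinarith
      have hc : c = M := by nlinarith
      rw [abs_of_neg hrn] at hr
      rw [abs_of_neg hsn] at hs
      refine ⟨r * s, mul_pos_of_neg_of_neg hrn hsn, by nlinarith, Or.inl fun x hx => ?_⟩
      have := hmaps _ hp _ (hmaps _ hq x hx)
      simp only [hb, hc] at this
      convert this using 1
      ring
    · have hc : c = M - s * M := by nlinarith
      rw [abs_of_pos hsp] at hs
      refine ⟨s, hs.1, hs.2, Or.inr fun x hx => ?_⟩
      have := hmaps _ hq x hx
      simp only [hc] at this
      convert this using 1
      ring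
  · have hb : b = 0 := by nlinarith
    rw [abs_of_pos hrp] at hr
    refine ⟨r, hr.1, hr.2, Or.inl fun x hx => ?_⟩
    simpa [hb] using hmaps _ hp x hx

end SelfSimilar

section Translations

variable {m : ℕ} {t : Fin (m + 1) → ℝ}

lemma mem_GammaT_iff {x : ℝ} : x ∈ GammaT N β t ↔ ∃ j, ∃ u ∈ Gamma N β, u + t j = x := by
  simp only [GammaT, Set.mem_iUnion, Set.mem_image]

lemma Gamma_subset_GammaT (ht0 : t 0 = 0) : Gamma N β ⊆ GammaT N β t :=
  fun x hx => mem_GammaT_iff.2 ⟨0, x, hx, by rw [ht0, add_zero]⟩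

lemma isCompact_GammaT (h : Small N β) : IsCompact (GammaT N β t) :=
  isCompact_iUnion fun _ => (isCompact_Gamma h).image (by fun_prop)

lemma conj_rev (j : Fin (m + 1)) : conj t (Fin.rev j) = t (Fin.last m) - t j := by
  unfold conj
  congr 2
  ext
  simp [Fin.val_rev]
  omega

lemma conj_conj (ht0 : t 0 = 0) : conj (conj t) = t := by
  funext j
  obtain ⟨i, rfl⟩ := Fin.rev_surjective j
  rw [conj_rev]
  obtain ⟨k, rfl⟩ := Fin.rev_surjective i
  rw [conj_rev, Fin.rev_rev, ← Fin.rev_zero, conj_rev, ht0, Fin.rev_zero]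
  ring

lemma conj_zero : conj t 0 = 0 := by
  rw [← Fin.rev_last, conj_rev, sub_self]

lemma strictMono_conj (hmono : StrictMono t) : StrictMono (conj t) := by
  intro i j hij
  rw [← Fin.rev_rev i, ← Fin.rev_rev j, conj_rev, conj_rev]
  exact sub_lt_sub_left (hmono (Fin.rev_lt_rev.2 hij)) _

lemma reflect_mem_GammaT_conj (h : Small N β) {x : ℝ} (hx : x ∈ GammaT N β t) :
    1 + t (Fin.last m) - x ∈ GammaT N β (conj t) := by
  obtain ⟨j, u, hu, rfl⟩ := mem_GammaT_iff.1 hx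
  refine mem_GammaT_iff.2 ⟨Fin.rev j, 1 - u, one_sub_mem_Gamma h hu, ?_⟩
  rw [conj_rev]
  ring

lemma conj_last (ht0 : t 0 = 0) : conj t (Fin.last m) = t (Fin.last m) := by
  rw [← Fin.rev_zero, conj_rev, ht0, sub_zero, Fin.rev_zero]

lemma GammaT_conj (h : Small N β) (ht0 : t 0 = 0) :
    GammaT N β (conj t) = (fun x => 1 + t (Fin.last m) - x) '' GammaT N β t := by
  refine Set.Subset.antisymm (fun x hx => ?_) ?_
  · have := reflect_mem_GammaT_conj h hx
    rw [conj_conj ht0, conj_last ht0] at this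
    exact ⟨_, this, by ring⟩
  · rintro _ ⟨x, hx, rfl⟩
    exact reflect_mem_GammaT_conj h hx

/-- The digit string `δ_τ … δ_1` placed at the positions `n - τ, …, n - 1`. -/
def placeDigits (τ n : ℕ) (δ : ℕ → ℕ) (k : ℕ) : ℤ := if n ≤ k + τ ∧ k < n then δ (n - k) else 0

lemma isDigits_placeDigits {τ n : ℕ} {δ : ℕ → ℕ} (hδ : ∀ k, δ k ≤ N) :
    IsDigits N (placeDigits τ n δ) := by
  intro k
  have := hδ (n - k)
  unfold placeDigits
  split_ifs <;> simp only [Set.mem_Icc] <;> omega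

lemma cylVal_placeDigits (h : Small N β) {τ n : ℕ} (hn : τ ≤ n) (δ : ℕ → ℕ) :
    cylVal N β n (placeDigits τ n δ) =
      β ^ n * ((1 - β) / N * ∑ k ∈ Finset.Icc 1 τ, (δ k : ℝ) * β ^ (-(k : ℤ))) := by
  rw [mul_left_comm, cylVal]
  congr 1
  rw [Finset.mul_sum]
  have : ∀ k ∈ Finset.range n, ((placeDigits τ n δ k : ℤ) : ℝ) * β ^ k =
      if n ≤ k + τ then (δ (n - k) : ℝ) * β ^ k else 0 := by
    intro k hk
    have hk := Finset.mem_range.1 hk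
    unfold placeDigits
    by_cases hnk : n ≤ k + τ <;> simp [hnk, hk]
  rw [Finset.sum_congr rfl this, ← Finset.sum_filter]
  refine Finset.sum_nbij' (fun k => n - k) (fun k => n - k) ?_ ?_ ?_ ?_ ?_
  · intro k hk
    simp only [Finset.mem_filter, Finset.mem_range, Finset.mem_Icc] at hk ⊢
    omega
  · intro k hk
    simp only [Finset.mem_filter, Finset.mem_range, Finset.mem_Icc] at hk ⊢
    omega
  · intro k hk
    simp only [Finset.mem_filter, Finset.mem_range] at hk
    omega
  · intro k hk
    simp only [Finset.mem_Icc] at hk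
    omega
  · intro k hk
    simp only [Finset.mem_filter, Finset.mem_range] at hk
    rw [mul_left_comm, ← zpow_natCast β n, ← zpow_add₀ h.pos.ne', ← zpow_natCast β k]
    congr 2
    omega

lemma mem_Tset_of_cylVal (h : Small N β) {n : ℕ} (hn : 1 ≤ n) {a : ℕ → ℤ} (ha : IsDigits N a)
    {x : ℝ} (hx : β ^ n * x = cylVal N β n a) : x ∈ Tset N β := by
  refine ⟨n, hn, fun k => (a (n - k)).toNat, fun k => ?_, ?_⟩
  · exact Int.toNat_le.2 (ha (n - k)).2
  · apply mul_left_cancel₀ (pow_pos h.pos n).ne'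
    rw [← cylVal_placeDigits h le_rfl fun k => (a (n - k)).toNat, hx]
    refine cylVal_congr fun k hk => ?_
    rw [placeDigits, if_pos ⟨by omega, hk⟩, Nat.sub_sub_self hk.le]
    exact (Int.toNat_of_nonneg (ha k).1).symm

lemma exists_isMinimalRep (hT : ∀ j, t j ∈ Tset N β) : ∃ τ d, IsMinimalRep N β t τ d := by
  classical
  have hex : ∃ τ d, IsDigitRep N β t τ d := by
    choose n _ c hc hct using hT
    refine ⟨Finset.univ.sup n, fun j k => if k ≤ n j then c j k else 0, ?_, fun j => ?_⟩
    · intro j k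
      have := hc j k
      dsimp only
      split_ifs <;> omega
    · rw [hct j]
      congr 1
      have hle : n j ≤ Finset.univ.sup n := Finset.le_sup (Finset.mem_univ j)
      rw [← Finset.sum_subset (Finset.Icc_subset_Icc_right hle)]
      · refine Finset.sum_congr rfl fun k hk => ?_
        dsimp only
        rw [if_pos (Finset.mem_Icc.1 hk).2]
      · intro k hk hk'
        dsimp only
        rw [if_neg, Nat.cast_zero, zero_mul]
        simp only [Finset.mem_Icc] at hk hk'
        omega
  obtain ⟨d, hd⟩ := Nat.find_spec hex
  exact ⟨Nat.find hex, d, hd, fun τ' hτ' d' hd' => Nat.find_min hex hτ' ⟨d', hd'⟩⟩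

lemma mem_Tset_of_scaling (h : Small N β) (ht0 : t 0 = 0) (hmono : StrictMono t) {r : ℝ}
    (hr0 : 0 < r) (hr1 : r < 1) (hr : ∀ x ∈ GammaT N β t, r * x ∈ GammaT N β t)
    (j : Fin (m + 1)) : t j ∈ Tset N β := by
  have hlim : ∀ j, j ≠ 0 → ∀ᶠ n : ℕ in Filter.atTop, r ^ n * (1 + t (Fin.last m)) < t j := by
    intro j hj
    have hpos : 0 < t j := ht0 ▸ hmono (Fin.pos_iff_ne_zero.2 hj)
    have := (tendsto_pow_atTop_nhds_zero_of_lt_one hr0.le hr1).mul_const (1 + t (Fin.last m))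
    rw [zero_mul] at this
    exact this.eventually_lt_const hpos
  have hlim' : ∀ᶠ n : ℕ in Filter.atTop, ∀ j, j ≠ 0 → r ^ n * (1 + t (Fin.last m)) < t j := by
    refine Filter.eventually_all.2 fun j => ?_
    by_cases hj : j = 0
    · exact .of_forall fun _ hj' => absurd hj hj'
    · exact (hlim j hj).mono fun _ hn _ => hn
  obtain ⟨n, hn, hn1⟩ := (hlim'.and (Filter.eventually_ge_atTop 1)).exists
  have hiter : ∀ n : ℕ, ∀ x ∈ GammaT N β t, r ^ n * x ∈ GammaT N β t := by
    intro n
    induction n with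
    | zero => intro x hx; simpa using hx
    | succ n ih =>
      intro x hx
      rw [pow_succ', mul_assoc]
      exact hr _ (ih x hx)
  have hsmall : ∀ x ∈ GammaT N β t, r ^ n * x ∈ Gamma N β := by
    intro x hx
    obtain ⟨i, u, hu, hux⟩ := mem_GammaT_iff.1 (hiter n x hx)
    by_cases hi : i = 0
    · rwa [← hux, hi, ht0, add_zero]
    · obtain ⟨l, v, hv, rfl⟩ := mem_GammaT_iff.1 hx
      have h1 := (Gamma_subset_Icc h hu).1
      have h2 := (Gamma_subset_Icc h hv).2
      have h3 := hmono.monotone (Fin.le_last l)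
      have h4 := hn i hi
      have h5 := pow_pos hr0 n
      nlinarith
  obtain ⟨p, a, ha, hpa⟩ := similitude_of_mapsTo h (pow_pos hr0 n).ne' (b := r ^ n * t j) (by
    intro x hx
    rw [← mul_add]
    exact hsmall _ (mem_GammaT_iff.2 ⟨j, x, hx, rfl⟩))
  have hpos := pow_pos hr0 n
  have hβp := pow_pos h.pos p
  rcases hpa with ⟨h1, h2⟩ | ⟨h1, -⟩
  · refine mem_Tset_of_cylVal h (n := p) ?_ ha (by rw [← h1, h2])
    by_contra hp
    have : r ^ n < 1 := pow_lt_one₀ hr0.le hr1 (by omega)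
    rw [h1, show p = 0 by omega, pow_zero] at this
    exact lt_irrefl _ this
  · linarith

/-- The first `n` digits of `z` arise from a word `w` all of whose translates by the digits of
the `t_i` (all added, or all subtracted, at the last `τ` positions) are words over `{0,…,N}`. -/
def IsCoveredAt (N τ : ℕ) (d : Fin (m + 1) → ℕ → ℕ) (n : ℕ) (z : ℕ → ℤ) : Prop :=
  ∃ j, (∀ k < n, placeDigits τ n (d j) k ≤ z k ∧
      ∀ i, z k - placeDigits τ n (d j) k + placeDigits τ n (d i) k ≤ N) ∨
    (∀ k < n, z k + placeDigits τ n (d j) k ≤ N ∧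
      ∀ i, placeDigits τ n (d i) k ≤ z k + placeDigits τ n (d j) k)

/-- Sequence form of the symbolic admissibility condition. -/
def Covers (N τ : ℕ) (d : Fin (m + 1) → ℕ → ℕ) : Prop :=
  ∃ ℓ, ∀ z, IsDigits N z → ∃ n, τ ≤ n ∧ n ≤ ℓ ∧ IsCoveredAt N τ d n z

lemma covers_of_isSelfSimilar (h : Small N β) (ht0 : t 0 = 0) {τ : ℕ}
    {d : Fin (m + 1) → ℕ → ℕ} (hd : IsDigitRep N β t τ d)
    (hss : IsSelfSimilar (GammaT N β t)) : Covers N τ d := by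
  have hβ := h.pos
  have hg := h.gap_pos
  have hE {n : ℕ} (j : Fin (m + 1)) : IsDigits N (placeDigits τ n (d j)) :=
    isDigits_placeDigits (hd.1 j)
  have hval {n : ℕ} (hn : τ ≤ n) (j : Fin (m + 1)) :
      cylVal N β n (placeDigits τ n (d j)) = β ^ n * t j := by
    rw [cylVal_placeDigits h hn, ← hd.2 j]
  have hsep : ∀ x ∈ GammaT N β t, ∀ y ∈ Gamma N β, |x - y| < (1 - β) / N - β →
      x ∈ Gamma N β := by
    intro x hx y hy hxy
    obtain ⟨j, u, hu, rfl⟩ := mem_GammaT_iff.1 hx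
    have hz : ∀ k < τ, placeDigits τ τ (d j) k = (0 : ℕ → ℤ) k := by
      refine digits_eq_of_abs_lt h τ (hE j) isDigits_zero hu hy ?_
      have h0 : cylVal N β τ 0 = 0 := by simp [cylVal]
      rw [hval le_rfl, h0, zero_add, ← mul_add, ← mul_sub, abs_mul, abs_of_pos (pow_pos hβ τ),
        mul_comm, add_comm (t j)]
      exact mul_lt_mul_of_pos_right hxy (pow_pos hβ τ)
    have : β ^ τ * t j = 0 := by
      rw [← hval le_rfl, cylVal_congr hz]
      simp [cylVal]
    rwa [(mul_eq_zero.1 this).resolve_left (pow_pos hβ τ).ne', add_zero]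
  obtain ⟨C, hC⟩ := Metric.isBounded_iff.1 (isCompact_GammaT (t := t) h).isBounded
  have hM : 0 < max C 1 := lt_max_of_lt_right one_pos
  obtain ⟨F, hF, hmaps, hcov⟩ := hss.exists_small
    (lt_min (div_pos hg hM) (pow_pos hβ τ))
  obtain ⟨ℓ, hℓ⟩ : ∃ ℓ : ℕ, ∀ p ∈ F, β ^ ℓ < |p.1| :=
    (Filter.eventually_all_finset F |>.2 fun p hp =>
      (tendsto_pow_atTop_nhds_zero_of_lt_one hβ.le h.lt_one).eventually_lt_const
        (hF p hp).1).exists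
  refine ⟨ℓ, fun z hz => ?_⟩
  have hx : (1 - β) / N * ∑' k : ℕ, (z k : ℝ) * β ^ k ∈ Gamma N β := ⟨z, hz, rfl⟩
  have htail := exists_tail h hz
  set x := (1 - β) / N * ∑' k : ℕ, (z k : ℝ) * β ^ k
  obtain ⟨⟨r, b⟩, hp, y, hy, hyx⟩ := hcov x (Gamma_subset_GammaT ht0 hx)
  have hrF := hF _ hp
  have hrℓ := hℓ _ hp
  dsimp only at hyx hrF hrℓ
  obtain ⟨hr0, hrε⟩ := hrF
  obtain ⟨hrg, hrτ⟩ := lt_min_iff.1 hrε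
  have hin : ∀ y' ∈ GammaT N β t, r * y' + b ∈ Gamma N β := by
    intro y' hy'
    refine hsep _ (hmaps _ hp y' hy') x hx ?_
    have hdist : |y' - y| ≤ max C 1 := (hC hy' hy).trans (le_max_left _ _)
    rw [← hyx, add_sub_add_right_eq_sub, ← mul_sub, abs_mul]
    exact (mul_le_mul_of_nonneg_left hdist hr0.le).trans_lt ((lt_div_iff₀ hM).1 hrg)
  have hclass : ∀ i, ∃ n a, IsDigits N a ∧ ((r = β ^ n ∧ r * t i + b = cylVal N β n a) ∨
      (r = -β ^ n ∧ r * t i + b = cylVal N β n a + β ^ n)) := by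
    intro i
    refine similitude_of_mapsTo h (abs_pos.1 hr0) fun u hu => ?_
    rw [← add_assoc, ← mul_add]
    exact hin _ (mem_GammaT_iff.2 ⟨i, u, hu, rfl⟩)
  obtain ⟨n, w, hw, hnw⟩ := hclass 0
  have hβn := pow_pos hβ n
  have habs : |r| = β ^ n := by
    rcases hnw with ⟨hr, -⟩ | ⟨hr, -⟩
    · rw [hr, abs_of_pos hβn]
    · rw [hr, abs_neg, abs_of_pos hβn]
  rw [habs] at hrτ hrℓ
  have hτn : τ ≤ n := ((pow_lt_pow_iff_right_of_lt_one₀ hβ h.lt_one).1 hrτ).le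
  have hnℓ : n ≤ ℓ := ((pow_lt_pow_iff_right_of_lt_one₀ hβ h.lt_one).1 hrℓ).le
  refine ⟨n, hτn, hnℓ, ?_⟩
  obtain ⟨j, u, hu, rfl⟩ := mem_GammaT_iff.1 hy
  obtain ⟨x', hx', hxx'⟩ := htail n
  have hzeq {a : ℕ → ℤ} (ha : IsDigits N a) {v : ℝ} (hv : v ∈ Gamma N β)
      (hxv : x = cylVal N β n a + β ^ n * v) : ∀ k < n, z k = a k := by
    refine digits_eq_of_abs_lt h n hz ha hx' hv ?_
    rw [← hxx', ← hxv, sub_self, abs_zero]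
    positivity
  rw [ht0, mul_zero, zero_add] at hnw
  refine ⟨j, ?_⟩
  rcases hnw with ⟨hr, hb⟩ | ⟨hr, hb⟩
  · have hadd : ∀ i, ∃ a, IsDigits N a ∧ cylVal N β n a = β ^ n * t i + b ∧
        ∀ k < n, w k + placeDigits τ n (d i) k = a k := by
      intro i
      obtain ⟨n', a, ha, ⟨hr', hb'⟩ | ⟨hr', -⟩⟩ := hclass i
      · obtain rfl : n = n' :=
          (pow_right_injective₀ hβ h.lt_one.ne) (hr.symm.trans hr')
        rw [hr] at hb'
        refine ⟨a, ha, hb'.symm, fun k hk => ?_⟩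
        have := digits_eq_zero_of_cylVal_eq_zero h n
          (e := w + placeDigits τ n (d i) - a) (fun k _ => ?_) ?_ k hk
        · simp only [Pi.sub_apply, Pi.add_apply] at this
          omega
        · have h1 := hw k
          have h2 := ha k
          have h3 := hE (n := n) i k
          simp only [Set.mem_Icc, Pi.sub_apply, Pi.add_apply] at h1 h2 h3 ⊢
          rw [abs_le]
          omega
        · rw [cylVal_sub, cylVal_add, hval hτn, ← hb, ← hb']
          ring
      · have := pow_pos hβ n'
        linarith
    obtain ⟨a, ha, haval, haw⟩ := hadd j
    have hza := hzeq ha hu (by rw [haval, ← hyx, hr]; ring)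
    refine Or.inl fun k hk => ⟨?_, fun i => ?_⟩
    · have := (hw k).1
      rw [hza k hk, ← haw k hk]
      omega
    · obtain ⟨a', ha', -, haw'⟩ := hadd i
      have := (ha' k).2
      rw [← haw' k hk] at this
      rw [hza k hk, ← haw k hk]
      omega
  · have hsub : ∀ i, ∃ a, IsDigits N a ∧ cylVal N β n a + β ^ n = -β ^ n * t i + b ∧
        ∀ k < n, w k - placeDigits τ n (d i) k = a k := by
      intro i
      obtain ⟨n', a, ha, ⟨hr', -⟩ | ⟨hr', hb'⟩⟩ := hclass i
      · have := pow_pos hβ n'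
        linarith
      · obtain rfl : n = n' :=
          (pow_right_injective₀ hβ h.lt_one.ne) (neg_injective (hr.symm.trans hr'))
        rw [hr] at hb'
        refine ⟨a, ha, hb'.symm, fun k hk => ?_⟩
        have := digits_eq_zero_of_cylVal_eq_zero h n
          (e := w - placeDigits τ n (d i) - a) (fun k _ => ?_) ?_ k hk
        · simp only [Pi.sub_apply] at this
          omega
        · have h1 := hw k
          have h2 := ha k
          have h3 := hE (n := n) i k
          simp only [Set.mem_Icc, Pi.sub_apply] at h1 h2 h3 ⊢
          rw [abs_le]
          omega
        · rw [cylVal_sub, cylVal_sub, hval hτn]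
          linarith
    obtain ⟨a, ha, haval, haw⟩ := hsub j
    have hza := hzeq ha (one_sub_mem_Gamma h hu) (by rw [← hyx, hr]; linarith)
    refine Or.inr fun k hk => ⟨?_, fun i => ?_⟩
    · have := (hw k).2
      rw [hza k hk, ← haw k hk]
      omega
    · obtain ⟨a', ha', -, haw'⟩ := hsub i
      have := (ha' k).1
      rw [← haw' k hk] at this
      rw [hza k hk, ← haw k hk]
      omega

lemma finite_cylVal (N : ℕ) (β : ℝ) (n : ℕ) :
    {v | ∃ a : ℕ → ℤ, (∀ k < n, a k ∈ Set.Icc 0 (N : ℤ)) ∧ v = cylVal N β n a}.Finite := by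
  induction n with
  | zero =>
    refine (Set.finite_singleton (0 : ℝ)).subset ?_
    rintro _ ⟨a, -, rfl⟩
    exact cylVal_zero a
  | succ n ih =>
    refine (ih.image2 (fun v (i : ℤ) => v + (1 - β) / N * (i * β ^ n))
      (Set.finite_Icc 0 (N : ℤ))).subset ?_
    rintro _ ⟨a, ha, rfl⟩
    exact ⟨_, ⟨a, fun k hk => ha k (by omega), rfl⟩, a n, ha n (by omega),
      (cylVal_succ_right n a).symm⟩

lemma isSelfSimilar_of_covers (h : Small N β) (ht0 : t 0 = 0) {τ : ℕ}
    {d : Fin (m + 1) → ℕ → ℕ} (hd : IsDigitRep N β t τ d) (hcov : Covers N τ d) :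
    IsSelfSimilar (GammaT N β t) := by
  have hβ := h.pos
  have hE {n : ℕ} (j : Fin (m + 1)) : IsDigits N (placeDigits τ n (d j)) :=
    isDigits_placeDigits (hd.1 j)
  have hval {n : ℕ} (hn : τ ≤ n) (j : Fin (m + 1)) :
      cylVal N β n (placeDigits τ n (d j)) = β ^ n * t j := by
    rw [cylVal_placeDigits h hn, ← hd.2 j]
  obtain ⟨ℓ, hℓ⟩ := hcov
  let V : Set ℝ := ⋃ n ∈ Finset.range (ℓ + 2),
    {v | ∃ a : ℕ → ℤ, (∀ k < n, a k ∈ Set.Icc 0 (N : ℤ)) ∧ v = cylVal N β n a}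
  let R : Set ℝ := ⋃ n ∈ Finset.range (ℓ + 2), {β ^ n, -β ^ n, 0}
  have hV : V.Finite := Set.Finite.biUnion (Finset.finite_toSet _) fun n _ => finite_cylVal N β n
  have hR : R.Finite := Set.Finite.biUnion (Finset.finite_toSet _) fun n _ => Set.toFinite _
  have hfin : {p : ℝ × ℝ | p ∈ R ×ˢ Set.image2 (· + ·) (Set.range t) (Set.image2 (· + ·) V R) ∧
      (0 < |p.1| ∧ |p.1| < 1) ∧ ∀ x ∈ GammaT N β t, p.1 * x + p.2 ∈ GammaT N β t}.Finite :=
    (hR.prod ((Set.finite_range t).image2 _ (hV.image2 _ hR))).subset fun _ hp => hp.1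
  refine isSelfSimilar_iff.2 ⟨⟨0, Gamma_subset_GammaT ht0 zero_mem_Gamma⟩, isCompact_GammaT h,
    hfin.toFinset, fun p hp => (hfin.mem_toFinset.1 hp).2.1,
    fun p hp => (hfin.mem_toFinset.1 hp).2.2, ?_⟩
  intro x hx
  obtain ⟨j₀, x₀, hx₀, rfl⟩ := mem_GammaT_iff.1 hx
  obtain ⟨i, hi, _, ⟨a, ha, rfl⟩, rfl⟩ := (mem_Gamma_iff_step h).1 hx₀
  obtain ⟨n, hτn, hnℓ, j, hj⟩ := hℓ a ha
  obtain ⟨u, hu, hau⟩ := exists_tail h ha n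
  rw [hau]
  have hpow : 0 < β ^ (n + 1) := pow_pos hβ _
  have hpow1 : β ^ (n + 1) < 1 := pow_lt_one₀ hβ.le h.lt_one (by omega)
  have hrange : n + 1 ∈ Finset.range (ℓ + 2) := Finset.mem_range.2 (by omega)
  have hmem : ∀ r ∈ ({β ^ (n + 1), -β ^ (n + 1), 0} : Set ℝ), r ∈ R := fun r hr =>
    Set.mem_biUnion hrange hr
  have hcons : ∀ w : ℕ → ℤ, (∀ k < n, w k ∈ Set.Icc 0 (N : ℤ)) →
      ∀ k < n + 1, consDigit i w k ∈ Set.Icc 0 (N : ℤ) := by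
    rintro w hw (_ | k) hk
    · exact hi
    · exact hw k (by omega)
  rcases hj with hj | hj
  · have hw : ∀ k < n, (a - placeDigits τ n (d j)) k ∈ Set.Icc 0 (N : ℤ) := by
      intro k hk
      have h1 := (hj k hk).1
      have h2 := (ha k).2
      have h3 := (hE (n := n) j k).1
      simp only [Pi.sub_apply, Set.mem_Icc]
      omega
    refine ⟨(β ^ (n + 1), t j₀ + (cylVal N β (n + 1) (consDigit i (a - placeDigits τ n (d j))) +
        0)),
      hfin.mem_toFinset.2 ⟨⟨hmem _ (by simp), _, ⟨j₀, rfl⟩, _,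
        ⟨_, Set.mem_biUnion hrange ⟨_, hcons _ hw, rfl⟩, 0, hmem _ (by simp), rfl⟩, rfl⟩, ?_, ?_⟩,
      u + t j, mem_GammaT_iff.2 ⟨j, u, hu, rfl⟩, ?_⟩
    · rw [abs_of_pos hpow]
      exact ⟨hpow, hpow1⟩
    · intro y hy
      obtain ⟨l, v, hv, rfl⟩ := mem_GammaT_iff.1 hy
      have hw' : ∀ k < n, (a - placeDigits τ n (d j) + placeDigits τ n (d l)) k ∈
          Set.Icc 0 (N : ℤ) := by
        intro k hk
        have h1 := (hj k hk).2 l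
        have h2 := (hw k hk).1
        have h3 := (hE (n := n) l k).1
        simp only [Pi.sub_apply, Pi.add_apply, Set.mem_Icc] at h2 ⊢
        omega
      refine mem_GammaT_iff.2 ⟨j₀, _, cylVal_add_mem h (n + 1) (hcons _ hw') hv, ?_⟩
      rw [cylVal_cons, cylVal_cons, cylVal_add, hval hτn]
      ring
    · dsimp only
      rw [cylVal_cons, cylVal_sub, hval hτn]
      ring
  · have hw : ∀ k < n, (a + placeDigits τ n (d j)) k ∈ Set.Icc 0 (N : ℤ) := by
      intro k hk
      have h1 := (hj k hk).1
      have h2 := (ha k).1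
      have h3 := (hE (n := n) j k).1
      simp only [Pi.add_apply, Set.mem_Icc]
      omega
    refine ⟨(-β ^ (n + 1), t j₀ + (cylVal N β (n + 1) (consDigit i (a + placeDigits τ n (d j))) +
        β ^ (n + 1))),
      hfin.mem_toFinset.2 ⟨⟨hmem _ (by simp), _, ⟨j₀, rfl⟩, _,
        ⟨_, Set.mem_biUnion hrange ⟨_, hcons _ hw, rfl⟩, _, hmem _ (by simp), rfl⟩, rfl⟩, ?_, ?_⟩,
      1 - u + t j, mem_GammaT_iff.2 ⟨j, _, one_sub_mem_Gamma h hu, rfl⟩, ?_⟩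
    · rw [abs_neg, abs_of_pos hpow]
      exact ⟨hpow, hpow1⟩
    · intro y hy
      obtain ⟨l, v, hv, rfl⟩ := mem_GammaT_iff.1 hy
      have hw' : ∀ k < n, (a + placeDigits τ n (d j) - placeDigits τ n (d l)) k ∈
          Set.Icc 0 (N : ℤ) := by
        intro k hk
        have h1 := (hj k hk).2 l
        have h2 := (hw k hk).2
        have h3 := (hE (n := n) l k).1
        simp only [Pi.sub_apply, Pi.add_apply, Set.mem_Icc] at h2 ⊢
        omega
      refine mem_GammaT_iff.2 ⟨j₀, _,
        cylVal_add_mem h (n + 1) (hcons _ hw') (one_sub_mem_Gamma h hv), ?_⟩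
      rw [cylVal_cons, cylVal_cons, cylVal_sub, hval hτn]
      ring
    · dsimp only
      rw [cylVal_cons, cylVal_add, hval hτn]
      ring

lemma mem_Words_iff {n : ℕ} {w : List ℕ} :
    w ∈ Words N n ↔ w.length = n ∧ ∀ k, w.getD k 0 ≤ N := by
  refine and_congr_right fun _ => ⟨fun hw k => ?_, fun hw x hx => ?_⟩
  · rcases lt_or_ge k w.length with hk | hk
    · rw [List.getD_eq_getElem _ _ hk]
      exact hw _ (List.getElem_mem hk)
    · rw [List.getD_eq_default _ _ hk]
      exact Nat.zero_le _
  · obtain ⟨k, hk, rfl⟩ := List.getElem_of_mem hx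
    rw [← List.getD_eq_getElem _ 0 hk]
    exact hw k

lemma le_digitSup (d : Fin (m + 1) → ℕ → ℕ) (j : Fin (m + 1)) (k : ℕ) :
    d j k ≤ digitSup d k :=
  Finset.le_sup (f := fun j => d j k) (Finset.mem_univ j)

lemma digitSup_add_le_iff {d : Fin (m + 1) → ℕ → ℕ} {x k : ℕ} :
    x + digitSup d k ≤ N ↔ ∀ j, x + d j k ≤ N := by
  refine ⟨fun hx j => (Nat.add_le_add_left (le_digitSup d j k) x).trans hx, fun hx => ?_⟩
  have : digitSup d k ≤ N - x := Finset.sup_le fun j _ => Nat.le_sub_of_add_le' (hx j)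
  have := hx 0
  omega

lemma digitSup_le_iff {d : Fin (m + 1) → ℕ → ℕ} {x k : ℕ} :
    digitSup d k ≤ x ↔ ∀ j, d j k ≤ x := by
  simp [digitSup, Finset.sup_le_iff]

/-- Coordinatewise description of `W_t^τ`. -/
lemma mem_Wset_iff {τ : ℕ} {d : Fin (m + 1) → ℕ → ℕ} {v : List ℕ} :
    v ∈ Wset N τ d ↔ v ∈ Words N τ ∧ ∃ j,
      (∀ k < τ, d j (τ - k) ≤ v.getD k 0 ∧
        ∀ i, v.getD k 0 - d j (τ - k) + d i (τ - k) ≤ N) ∨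
      (∀ k < τ, v.getD k 0 + d j (τ - k) ≤ N ∧
        ∀ i, d i (τ - k) ≤ v.getD k 0 + d j (τ - k)) := by
  have hget : ∀ (f : ℕ → ℕ) (k : ℕ), (List.ofFn fun i : Fin τ => f i).getD k 0 =
      if k < τ then f k else 0 := by
    intro f k
    split_ifs with hk
    · rw [List.getD_eq_getElem _ _ (by simpa using hk), List.getElem_ofFn]
    · rw [List.getD_eq_default _ _ (by simpa using hk)]
  have hext : ∀ (f : ℕ → ℕ), v.length = τ → (∀ k < τ, v.getD k 0 = f k) →
      v = List.ofFn fun i : Fin τ => f i := by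
    intro f hlen hf
    refine List.ext_getElem (by simpa using hlen) fun k hk _ => ?_
    rw [← List.getD_eq_getElem _ 0 hk, hf k (hlen ▸ hk), List.getElem_ofFn]
  constructor
  · rintro (⟨w, ⟨hw, hs⟩, j, rfl⟩ | ⟨w, ⟨hw, hs⟩, j, rfl⟩)
    · have hs' : ∀ k < τ, ∀ i, w.getD k 0 + d i (τ - k) ≤ N := by
        intro k hk
        have := hs (τ - k) (by omega) (by omega)
        rw [Nat.sub_sub_self hk.le] at this
        exact digitSup_add_le_iff.1 this
      refine ⟨mem_Words_iff.2 ⟨by simp, fun k => ?_⟩, j, Or.inl fun k hk => ?_⟩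
      · rw [hget fun k => w.getD k 0 + d j (τ - k)]
        split_ifs with hk
        · exact hs' k hk j
        · exact Nat.zero_le _
      · rw [hget fun k => w.getD k 0 + d j (τ - k), if_pos hk]
        refine ⟨Nat.le_add_left _ _, fun i => ?_⟩
        rw [Nat.add_sub_cancel]
        exact hs' k hk i
    · have hs' : ∀ k < τ, ∀ i, d i (τ - k) ≤ w.getD k 0 := by
        intro k hk
        have := hs (τ - k) (by omega) (by omega)
        rw [Nat.sub_sub_self hk.le] at this
        exact digitSup_le_iff.1 this
      have hwN := (mem_Words_iff.1 hw).2
      refine ⟨mem_Words_iff.2 ⟨by simp, fun k => ?_⟩, j, Or.inr fun k hk => ?_⟩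
      · rw [hget fun k => w.getD k 0 - d j (τ - k)]
        split_ifs with hk
        · exact (Nat.sub_le _ _).trans (hwN k)
        · exact Nat.zero_le _
      · rw [hget fun k => w.getD k 0 - d j (τ - k), if_pos hk, Nat.sub_add_cancel (hs' k hk j)]
        exact ⟨hwN k, hs' k hk⟩
  · rintro ⟨hv, j, hj | hj⟩ <;> obtain ⟨hlen, hvN⟩ := mem_Words_iff.1 hv
    · refine Or.inl ⟨List.ofFn fun k : Fin τ => v.getD k 0 - d j (τ - k),
        ⟨mem_Words_iff.2 ⟨by simp, fun k => ?_⟩, fun k hk hkτ => ?_⟩, j,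
        hext (fun k => (List.ofFn fun i : Fin τ => v.getD i 0 - d j (τ - i)).getD k 0 +
          d j (τ - k)) hlen fun k hk => ?_⟩
      · rw [hget fun k => v.getD k 0 - d j (τ - k)]
        split_ifs
        · exact (Nat.sub_le _ _).trans (hvN k)
        · exact Nat.zero_le _
      · rw [hget fun k => v.getD k 0 - d j (τ - k), if_pos (by omega), digitSup_add_le_iff]
        intro i
        have := (hj (τ - k) (by omega)).2 i
        rwa [Nat.sub_sub_self hkτ] at this ⊢
      · rw [hget fun k => v.getD k 0 - d j (τ - k), if_pos hk]
        exact (Nat.sub_add_cancel (hj k hk).1).symm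
    · refine Or.inr ⟨List.ofFn fun k : Fin τ => v.getD k 0 + d j (τ - k),
        ⟨mem_Words_iff.2 ⟨by simp, fun k => ?_⟩, fun k hk hkτ => ?_⟩, j,
        hext (fun k => (List.ofFn fun i : Fin τ => v.getD i 0 + d j (τ - i)).getD k 0 -
          d j (τ - k)) hlen fun k hk => ?_⟩
      · rw [hget fun k => v.getD k 0 + d j (τ - k)]
        split_ifs with hk
        · exact (hj k hk).1
        · exact Nat.zero_le _
      · rw [hget fun k => v.getD k 0 + d j (τ - k), if_pos (by omega), digitSup_le_iff]
        intro i
        have := (hj (τ - k) (by omega)).2 i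
        rwa [Nat.sub_sub_self hkτ] at this ⊢
      · rw [hget fun k => v.getD k 0 + d j (τ - k), if_pos hk]
        exact (Nat.add_sub_cancel _ _).symm

lemma isCoveredAt_iff {τ n : ℕ} (hn : τ ≤ n) {d : Fin (m + 1) → ℕ → ℕ} {z : ℕ → ℤ}
    (hz : IsDigits N z) {v : List ℕ} (hv : v.length = τ)
    (hvz : ∀ k < τ, (v.getD k 0 : ℤ) = z (n - τ + k)) :
    IsCoveredAt N τ d n z ↔ v ∈ Wset N τ d := by
  have hword : v ∈ Words N τ := by
    refine mem_Words_iff.2 ⟨hv, fun k => ?_⟩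
    rcases lt_or_ge k τ with hk | hk
    · have := (hz (n - τ + k)).2
      rw [← hvz k hk] at this
      exact_mod_cast this
    · rw [List.getD_eq_default _ _ (hv ▸ hk)]
      exact Nat.zero_le _
  have hplace : ∀ i, ∀ k < τ, placeDigits τ n (d i) (n - τ + k) = d i (τ - k) := by
    intro i k hk
    rw [placeDigits, if_pos (by omega), show n - (n - τ + k) = τ - k by omega]
  have hplace0 : ∀ i, ∀ k < n - τ, placeDigits τ n (d i) k = 0 := by
    intro i k hk
    rw [placeDigits, if_neg (by omega)]
  have hsplit : ∀ P : ℕ → Prop, (∀ k < n - τ, P k) →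
      ((∀ k < n, P k) ↔ ∀ k < τ, P (n - τ + k)) := by
    intro P hP
    refine ⟨fun hk k hkτ => hk _ (by omega), fun hk k hkn => ?_⟩
    rcases lt_or_ge k (n - τ) with hlt | hge
    · exact hP k hlt
    · have := hk (k - (n - τ)) (by omega)
      rwa [Nat.add_sub_cancel' hge] at this
  rw [mem_Wset_iff, and_iff_right hword]
  refine exists_congr fun j => or_congr ?_ ?_
  · rw [hsplit]
    · refine forall₂_congr fun k hk => ?_
      simp only [hplace _ k hk, ← hvz k hk]
      constructor
      · rintro ⟨h1, h2⟩
        refine ⟨by omega, fun i => ?_⟩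
        have := h2 i
        omega
      · rintro ⟨h1, h2⟩
        refine ⟨by omega, fun i => ?_⟩
        have := h2 i
        omega
    · intro k hk
      have := hz k
      simp only [hplace0 _ k hk, Set.mem_Icc] at this ⊢
      exact ⟨this.1, fun _ => by omega⟩
  · rw [hsplit]
    · refine forall₂_congr fun k hk => ?_
      simp only [hplace _ k hk, ← hvz k hk]
      norm_cast
    · intro k hk
      have := hz k
      simp only [hplace0 _ k hk, Set.mem_Icc] at this ⊢
      exact ⟨by omega, fun _ => by omega⟩

lemma admissibleWith_iff_covers {τ : ℕ} {d : Fin (m + 1) → ℕ → ℕ} :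
    AdmissibleWith N τ d ↔ Covers N τ d := by
  constructor
  · rintro ⟨ℓ, hτℓ, hℓ⟩
    refine ⟨ℓ, fun z hz => ?_⟩
    have hget : ∀ k < ℓ, ((List.ofFn fun k : Fin ℓ => (z k).toNat).getD k 0 : ℤ) = z k := by
      intro k hk
      rw [List.getD_eq_getElem _ _ (by simpa using hk), List.getElem_ofFn]
      exact Int.toNat_of_nonneg (hz k).1
    have hZ : (List.ofFn fun k : Fin ℓ => (z k).toNat) ∈ Words N ℓ := by
      refine ⟨by simp, fun x hx => ?_⟩
      obtain ⟨k, rfl⟩ := List.mem_ofFn.1 hx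
      exact Int.toNat_le.2 (hz k).2
    rw [← hℓ] at hZ
    simp only [Set.mem_iUnion, Finset.mem_Icc, exists_prop] at hZ
    obtain ⟨n, ⟨hτn, hnℓ⟩, u, hu, w, hw, v, hv, huwv⟩ := hZ
    have hwlen := (mem_Wset_iff.1 hw).1.1
    refine ⟨n, hτn, hnℓ, (isCoveredAt_iff hτn hz hwlen fun k hk => ?_).2 hw⟩
    rw [← hget _ (by omega), huwv, List.append_assoc,
      List.getD_append_right _ _ _ _ (by rw [hu.1]; omega), hu.1, Nat.add_sub_cancel_left,
      List.getD_append _ _ _ _ (by omega)]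
  · rintro ⟨ℓ, hℓ⟩
    obtain ⟨n₀, hτn₀, hn₀ℓ, -⟩ := hℓ 0 isDigits_zero
    refine ⟨ℓ, hτn₀.trans hn₀ℓ, Set.Subset.antisymm ?_ ?_⟩
    · intro z hz
      simp only [Set.mem_iUnion, Finset.mem_Icc, exists_prop] at hz
      obtain ⟨n, ⟨hτn, hnℓ⟩, u, hu, w, hw, v, hv, rfl⟩ := hz
      have hw := (mem_Wset_iff.1 hw).1
      refine ⟨?_, fun x hx => ?_⟩
      · rw [List.length_append, List.length_append, hu.1, hw.1, hv.1]
        omega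
      · rcases List.mem_append.1 hx with hx | hx
        · exact (List.mem_append.1 hx).elim (hu.2 x) (hw.2 x)
        · exact hv.2 x hx
    · intro Z hZ
      have hz : IsDigits N fun k => (Z.getD k 0 : ℤ) := fun k =>
        ⟨Int.natCast_nonneg _, Int.ofNat_le.2 ((mem_Words_iff.1 hZ).2 k)⟩
      obtain ⟨n, hτn, hnℓ, hcov⟩ := hℓ _ hz
      have hlen := hZ.1
      have hw : ((Z.drop (n - τ)).take τ).length = τ := by
        rw [List.length_take, List.length_drop]
        omega
      rw [isCoveredAt_iff hτn hz hw ?_] at hcov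
      · simp only [Set.mem_iUnion, Finset.mem_Icc, exists_prop]
        refine ⟨n, ⟨hτn, hnℓ⟩, Z.take (n - τ), ⟨?_, fun x hx => hZ.2 x (List.mem_of_mem_take hx)⟩,
          _, hcov, Z.drop n, ⟨?_, fun x hx => hZ.2 x (List.mem_of_mem_drop hx)⟩, ?_⟩
        · rw [List.length_take]
          omega
        · rw [List.length_drop, hlen]
        · have : Z.drop n = (Z.drop (n - τ)).drop τ := by
            rw [List.drop_drop, Nat.sub_add_cancel hτn]
          rw [this, List.append_assoc, List.take_append_drop, List.take_append_drop]
      · intro k hk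
        rw [List.getD_eq_getElem _ _ (by omega), List.getElem_take, List.getElem_drop,
          List.getD_eq_getElem]

lemma IsAdmissible.isSelfSimilar (h : Small N β) (ht0 : t 0 = 0) (hadm : IsAdmissible N β t) :
    IsSelfSimilar (GammaT N β t) := by
  obtain ⟨-, τ, d, hd, hcov⟩ := hadm
  exact isSelfSimilar_of_covers h ht0 hd.1 (admissibleWith_iff_covers.1 hcov)

lemma IsSelfSimilar.isAdmissible (h : Small N β) (ht0 : t 0 = 0)
    (hss : IsSelfSimilar (GammaT N β t)) (hT : ∀ j, t j ∈ Tset N β) : IsAdmissible N β t := by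
  obtain ⟨τ, d, hd⟩ := exists_isMinimalRep hT
  exact ⟨hT, τ, d, hd, admissibleWith_iff_covers.2 (covers_of_isSelfSimilar h ht0 hd.1 hss)⟩

lemma isSelfSimilar_GammaT_conj (h : Small N β) (ht0 : t 0 = 0)
    (hss : IsSelfSimilar (GammaT N β t)) : IsSelfSimilar (GammaT N β (conj t)) := by
  rw [GammaT_conj h ht0]
  exact hss.reflect _

lemma GammaT_subset_Icc (h : Small N β) (ht0 : t 0 = 0) (hmono : StrictMono t) :
    GammaT N β t ⊆ Set.Icc 0 (1 + t (Fin.last m)) := by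
  intro x hx
  obtain ⟨j, u, hu, rfl⟩ := mem_GammaT_iff.1 hx
  have hu := Gamma_subset_Icc h hu
  have h1 := hmono.monotone (Fin.zero_le j)
  have h2 := hmono.monotone (Fin.le_last j)
  rw [ht0] at h1
  exact ⟨add_nonneg hu.1 h1, add_le_add hu.2 h2⟩

end Translations

/-- Suppose `0 < β < 1/(2N+1)` and `t = (t_0,…,t_m)` with `0 = t_0 < t_1 < ⋯ < t_m`.
Then `Γ_t = ⋃_{j=0}^m (Γ + t_j)` is a self-similar set iff either `t` or its conjugate
`t̂` is an admissible translation vector. -/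
theorem stmt3 (N : ℕ) (hN : 0 < N) (β : ℝ) (hβ0 : 0 < β) (hβ1 : β < 1 / (2 * N + 1))
    (m : ℕ) (t : Fin (m + 1) → ℝ) (ht0 : t 0 = 0) (hmono : StrictMono t) :
    IsSelfSimilar (GammaT N β t) ↔
      IsAdmissible N β t ∨ IsAdmissible N β (conj t) := by
  have h : Small N β := ⟨hN, hβ0, (lt_div_iff₀ (by positivity)).1 hβ1⟩
  constructor
  · intro hss
    obtain ⟨r, hr0, hr1, hr | hr⟩ := hss.exists_fixing_endpoint (GammaT_subset_Icc h ht0 hmono)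
      (Gamma_subset_GammaT ht0 zero_mem_Gamma)
      (mem_GammaT_iff.2 ⟨Fin.last m, 1, one_mem_Gamma h, rfl⟩)
    · exact Or.inl (hss.isAdmissible h ht0 (mem_Tset_of_scaling h ht0 hmono hr0 hr1 hr))
    · refine Or.inr ((isSelfSimilar_GammaT_conj h ht0 hss).isAdmissible h conj_zero
        (mem_Tset_of_scaling h conj_zero (strictMono_conj hmono) hr0 hr1 ?_))
      rw [GammaT_conj h ht0]
      rintro _ ⟨x, hx, rfl⟩
      exact ⟨_, hr x hx, by ring⟩
  · rintro (hadm | hadm)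
    · exact hadm.isSelfSimilar h ht0
    · have := isSelfSimilar_GammaT_conj h conj_zero (hadm.isSelfSimilar h conj_zero)
      rwa [conj_conj ht0] at this

end HSCantor
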